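/- If G is an SGK graph, then the sequence Δα_k(G) = α_k(G) - α_{k-1}(G) (k = 1, 2, …) is a nonincreasing sequence; in particular, for every positive integer k, α_{k+1}(G) - α_k(G) ≤ α_k(G) - α_{k-1}(G). -/

import Mathlib

/-- `s` is an independent set of the graph `G`. -/
def IndepSet {V : Type*} (G : SimpleGraph V) (s : Set V) : Prop :=
  ∀ ⦃v⦄, v ∈ s → ∀ ⦃w⦄, w ∈ s → ¬ G.Adj v w

/-- `α_k(G)`: the maximum number of vertices in a union of `k` independent sets. -/
noncomputable def alphak {V : Type*} (G : SimpleGraph V) (k : ℕ) : ℕ :=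
  sSup {n | ∃ A : Fin k → Set V, (∀ i, IndepSet G (A i)) ∧ (⋃ i, A i).ncard = n}

/-- `ω_k(G)`: the maximum number of vertices in a union of `k` cliques. -/
noncomputable def omegak {V : Type*} (G : SimpleGraph V) (k : ℕ) : ℕ :=
  sSup {n | ∃ A : Fin k → Set V, (∀ i, G.IsClique (A i)) ∧ (⋃ i, A i).ncard = n}

/-- The clique number `ω(G)`. -/
noncomputable def cliqueNumber {V : Type*} (G : SimpleGraph V) : ℕ :=
  sSup {n | ∃ s : Set V, G.IsClique s ∧ s.ncard = n}

/-- The independence number `α(G)`. -/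
noncomputable def indepNumber {V : Type*} (G : SimpleGraph V) : ℕ :=
  sSup {n | ∃ s : Set V, IndepSet G s ∧ s.ncard = n}

/-- `f` encodes a partition of the vertices of `G` into cliques:
its (nonempty) fibers are the cliques. -/
def IsCliquePartition {V : Type*} (G : SimpleGraph V) (f : V → V) : Prop :=
  ∀ i : V, G.IsClique (f ⁻¹' {i})

/-- The `k`-norm of the partition encoded by `f`: `Σ_C min (k, |C|)`. -/
noncomputable def knorm {V : Type*} [Fintype V] (f : V → V) (k : ℕ) : ℕ :=
  ∑ i : V, min k (f ⁻¹' {i}).ncard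

/-- `G` is a strong Greene–Kleitman (SGK) graph: every induced subgraph has, for every
positive `k`, a clique partition that is simultaneously `k`- and `k+1`-saturated. -/
def SGK {V : Type*} [Fintype V] (G : SimpleGraph V) : Prop :=
  ∀ (s : Finset V) (k : ℕ), 0 < k →
    ∃ f : (↑s : Set V) → (↑s : Set V),
      IsCliquePartition (G.induce ↑s) f ∧
      knorm f k = alphak (G.induce ↑s) k ∧
      knorm f (k + 1) = alphak (G.induce ↑s) (k + 1)

/-- An SGK graph is polyunsaturated if no clique partition is simultaneously `k`- and
`l`-saturated for distinct nonconsecutive positive `k, l` below the clique number. -/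
def PolyunsatG {V : Type*} [Fintype V] (G : SimpleGraph V) : Prop :=
  ∀ k l : ℕ, 0 < k → 0 < l → k < cliqueNumber G → l < cliqueNumber G →
    (k + 2 ≤ l ∨ l + 2 ≤ k) →
    ¬ ∃ f : V → V, IsCliquePartition G f ∧ knorm f k = alphak G k ∧ knorm f l = alphak G l

/-- `G` is a comparability graph: adjacency is comparability in some partial order. -/
def IsComparabilityGraph {V : Type*} (G : SimpleGraph V) : Prop :=
  ∃ r : V → V → Prop, IsPartialOrder V r ∧ ∀ v w, G.Adj v w ↔ (v ≠ w ∧ (r v w ∨ r w v))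


theorem ncard_inter_iUnion_le {V : Type*} [Finite V] {G : SimpleGraph V} {C : Set V}
    (hC : G.IsClique C) {k : ℕ} {A : Fin k → Set V} (hA : ∀ i, IndepSet G (A i)) :
    (C ∩ ⋃ i, A i).ncard ≤ k := by
  rw [Set.inter_iUnion]
  refine (Set.ncard_iUnion_le_of_fintype _).trans ?_
  refine (Finset.sum_le_card_nsmul Finset.univ _ 1 fun i _ => ?_).trans (by simp)
  rw [Set.ncard_le_one_iff]
  intro a b ha hb
  by_contra hab
  exact hA i ha.2 hb.2 (hC ha.1 hb.1 hab)

theorem alphak_le_knorm {V : Type*} [Fintype V] {G : SimpleGraph V} {f : V → V}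
    (hf : IsCliquePartition G f) (k : ℕ) : alphak G k ≤ knorm f k := by
  refine csSup_le ⟨_, fun _ => ∅, fun _ _ h => h.elim, rfl⟩ ?_
  rintro n ⟨A, hA, rfl⟩
  have hcover : (⋃ i, A i) = ⋃ v, f ⁻¹' {v} ∩ ⋃ i, A i := by
    ext x
    simp
  rw [hcover]
  exact (Set.ncard_iUnion_le_of_fintype _).trans (Finset.sum_le_sum fun v _ =>
    le_min (ncard_inter_iUnion_le (hf v) hA) (Set.ncard_le_ncard Set.inter_subset_left))

theorem knorm_concave {V : Type*} [Fintype V] (f : V → V) {k : ℕ} (hk : 0 < k) :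
    knorm f (k + 1) + knorm f (k - 1) ≤ 2 * knorm f k := by
  unfold knorm
  rw [← Finset.sum_add_distrib, Finset.mul_sum]
  exact Finset.sum_le_sum fun v _ => by omega

theorem alphak_congr {V W : Type*} {G : SimpleGraph V} {H : SimpleGraph W} (e : G ≃g H)
    (k : ℕ) : alphak G k = alphak H k := by
  unfold alphak
  congr 1
  ext n
  constructor
  · rintro ⟨A, hA, rfl⟩
    refine ⟨fun i => e '' A i, ?_, ?_⟩
    · rintro i _ ⟨v, hv, rfl⟩ _ ⟨w, hw, rfl⟩ h
      exact hA i hv hw (e.map_adj_iff.1 h)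
    · rw [← Set.image_iUnion, Set.ncard_image_of_injective _ e.injective]
  · rintro ⟨A, hA, rfl⟩
    refine ⟨fun i => e.symm '' A i, ?_, ?_⟩
    · rintro i _ ⟨v, hv, rfl⟩ _ ⟨w, hw, rfl⟩ h
      exact hA i hv hw (e.symm.map_adj_iff.1 h)
    · rw [← Set.image_iUnion, Set.ncard_image_of_injective _ e.symm.injective]

theorem alphak_induce_coe_univ {V : Type*} [Fintype V] (G : SimpleGraph V) (k : ℕ) :
    alphak (G.induce (↑(Finset.univ : Finset V) : Set V)) k = alphak G k := by
  rw [Finset.coe_univ]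
  exact alphak_congr G.induceUnivIso k

/-- If `G` is an SGK graph, then the sequence `Δα_k(G)` is nonincreasing: for every
positive `k`, `α_{k+1}(G) - α_k(G) ≤ α_k(G) - α_{k-1}(G)` (stated additively). -/
theorem statement6 {V : Type*} [Fintype V] (G : SimpleGraph V) (hG : SGK G) :
    ∀ k : ℕ, 0 < k → alphak G (k + 1) + alphak G (k - 1) ≤ 2 * alphak G k := by
  intro k hk
  obtain ⟨f, hf, hfk, hfk'⟩ := hG Finset.univ k hk
  have hle := alphak_le_knorm hf (k - 1)
  have hconc := knorm_concave f hk
  rw [alphak_induce_coe_univ] at hfk hfk' hle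
  omega
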